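/- Let a, b ∈ EuclideanSpace ℝ (Fin 3) with a ≠ b, and let i, j ∈ Fin 3. Then the function y ↦ ((y − a) i · (y − b) j)/(‖y − a‖³ · ‖y − b‖³) is integrable on EuclideanSpace ℝ (Fin 3) with respect to Lebesgue measure, and ∫ ((y − a) i · (y − b) j)/(‖y − a‖³ · ‖y − b‖³) dy = (2π/‖a − b‖) · ( δ_{ij} − ((a − b) i · (a − b) j)/‖a − b‖² ), where δ_{ij} is 1 if i = j and 0 otherwise. Equivalently, ∫ ∂_i(1/‖y − a‖) · ∂_j(1/‖y − b‖) dy = (2π/‖a−b‖)(δ_{ij} − n̂_i n̂_j) with n̂ the unit vector along a − b. -/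

import Mathlib

open MeasureTheory

/-- Second moment of a centred Gaussian. -/
lemma integral_sq_mul_exp_neg_mul_sq {c : ℝ} (hc : 0 < c) :
    ∫ z : ℝ, z ^ 2 * Real.exp (-c * z ^ 2) = √(Real.pi / c) / (2 * c) := by
  have h1 := integral_comp_abs (f := fun z : ℝ => z ^ 2 * Real.exp (-c * z ^ 2))
  simp only [sq_abs] at h1
  have h2 := integral_rpow_mul_exp_neg_mul_rpow (p := 2) (q := 2) (b := c) (by norm_num)
    (by norm_num) hc
  simp only [Real.rpow_two] at h2
  have h3 : Real.Gamma ((2 + 1) / 2) = √Real.pi / 2 := by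
    rw [show ((2 : ℝ) + 1) / 2 = 1 / 2 + 1 by norm_num, Real.Gamma_add_one (by norm_num),
      Real.Gamma_one_half_eq]
    ring
  have h4 : c ^ (-(2 + 1) / 2 : ℝ) = (c * √c)⁻¹ := by
    rw [show (-(2 + 1) / 2 : ℝ) = -(1 + 1 / 2) by norm_num, Real.rpow_neg hc.le,
      Real.rpow_add hc, Real.rpow_one, Real.sqrt_eq_rpow]
  rw [h1, h2, h3, h4, Real.sqrt_div Real.pi_pos.le]
  field_simp

/-- The second moment of a centred Gaussian exists. -/
lemma integrable_sq_mul_exp_neg_mul_sq {c : ℝ} (hc : 0 < c) :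
    Integrable fun z : ℝ => z ^ 2 * Real.exp (-c * z ^ 2) := by
  simpa using integrable_rpow_mul_exp_neg_mul_sq hc (s := 2) (by norm_num)

/-- The first moment of a centred Gaussian vanishes. -/
lemma integral_mul_exp_neg_mul_sq (c : ℝ) :
    ∫ z : ℝ, z * Real.exp (-c * z ^ 2) = 0 := by
  have h := integral_neg_eq_self (fun z : ℝ => z * Real.exp (-c * z ^ 2)) volume
  simp only [neg_sq, neg_mul, integral_neg] at h ⊢
  linarith

lemma integral_affine_mul_affine_mul_exp_neg_mul_sq {c : ℝ} (hc : 0 < c) (A B C D : ℝ) :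
    ∫ z : ℝ, (A + B * z) * (C + D * z) * Real.exp (-c * z ^ 2) =
      (A * C + B * D / (2 * c)) * √(Real.pi / c) := by
  have h0 := integrable_exp_neg_mul_sq hc
  have h1 := integrable_mul_exp_neg_mul_sq hc
  have h2 := integrable_sq_mul_exp_neg_mul_sq hc
  have : ∀ z : ℝ, (A + B * z) * (C + D * z) * Real.exp (-c * z ^ 2) =
      A * C * Real.exp (-c * z ^ 2) + (A * D + B * C) * (z * Real.exp (-c * z ^ 2)) +
        B * D * (z ^ 2 * Real.exp (-c * z ^ 2)) := fun z => by ring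
  simp_rw [this]
  have h01 : Integrable fun z : ℝ => A * C * Real.exp (-c * z ^ 2) +
      (A * D + B * C) * (z * Real.exp (-c * z ^ 2)) := (h0.const_mul _).add (h1.const_mul _)
  rw [integral_add h01 (h2.const_mul _),
    integral_add (h0.const_mul _) (h1.const_mul _), integral_const_mul, integral_const_mul,
    integral_const_mul, integral_gaussian, integral_mul_exp_neg_mul_sq,
    integral_sq_mul_exp_neg_mul_sq hc]
  ring

/-- Product of two Gaussians with different centres, weighted by two affine functions. -/
lemma integral_affine_mul_affine_mul_exp_mul_exp {s t : ℝ} (hs : 0 < s) (ht : 0 < t)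
    (a b P B Q D : ℝ) :
    ∫ x : ℝ, (P + B * (x - a)) * (Q + D * (x - b)) *
        (Real.exp (-(s * (x - a) ^ 2)) * Real.exp (-(t * (x - b) ^ 2))) =
      ((P - B * (t * (a - b) / (s + t))) * (Q + D * (s * (a - b) / (s + t))) +
        B * D / (2 * (s + t))) * √(Real.pi / (s + t)) *
        Real.exp (-(s * t / (s + t) * (a - b) ^ 2)) := by
  have hst : 0 < s + t := by positivity
  rw [← integral_add_right_eq_self _ ((s * a + t * b) / (s + t)),
    ← integral_affine_mul_affine_mul_exp_neg_mul_sq hst, ← integral_mul_const]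
  congr 1 with z
  have e1 : -(s * (z + (s * a + t * b) / (s + t) - a) ^ 2) +
      -(t * (z + (s * a + t * b) / (s + t) - b) ^ 2) =
      -(s + t) * z ^ 2 + -(s * t / (s + t) * (a - b) ^ 2) := by
    field_simp
    ring
  have e2 : z + (s * a + t * b) / (s + t) - a = z - t * (a - b) / (s + t) := by
    field_simp
    ring
  have e3 : z + (s * a + t * b) / (s + t) - b = z + s * (a - b) / (s + t) := by
    field_simp
    ring
  rw [← Real.exp_add, e1, e2, e3, Real.exp_add]
  ring

lemma integral_coord_mul_coord_mul_gaussian {s t : ℝ} (hs : 0 < s) (ht : 0 < t)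
    (a b : EuclideanSpace ℝ (Fin 3)) (i j : Fin 3) :
    ∫ y : EuclideanSpace ℝ (Fin 3), (y - a) i * (y - b) j *
        (Real.exp (-(s * ‖y - a‖ ^ 2)) * Real.exp (-(t * ‖y - b‖ ^ 2))) =
      √(Real.pi / (s + t)) ^ 3 * Real.exp (-(s * t / (s + t) * ‖a - b‖ ^ 2)) *
        ((if i = j then (1 : ℝ) else 0) / (2 * (s + t)) -
          s * t * ((a - b) i * (a - b) j) / (s + t) ^ 2) := by
  let p : Fin 3 → Fin 3 → ℝ := fun l k => if k = l then 0 else 1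
  let f : Fin 3 → ℝ → ℝ := fun k x =>
    (p i k + (1 - p i k) * (x - a k)) * (p j k + (1 - p j k) * (x - b k)) *
        (Real.exp (-(s * (x - a k) ^ 2)) * Real.exp (-(t * (x - b k) ^ 2)))
  have hf : ∀ y : EuclideanSpace ℝ (Fin 3), (y - a) i * (y - b) j *
        (Real.exp (-(s * ‖y - a‖ ^ 2)) * Real.exp (-(t * ‖y - b‖ ^ 2))) =
      ∏ k, f k (y.ofLp k) := by
    intro y
    simp only [f, Finset.prod_mul_distrib, ← Real.exp_sum, EuclideanSpace.real_norm_sq_eq,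
      Finset.sum_neg_distrib, Finset.mul_sum, PiLp.sub_apply]
    congr 1
    fin_cases i <;> fin_cases j <;> simp [Fin.prod_univ_three, p]
  simp_rw [hf]
  rw [(PiLp.volume_preserving_ofLp (Fin 3)).integral_comp
    (MeasurableEquiv.toLp 2 (Fin 3 → ℝ)).symm.measurableEmbedding (fun y => ∏ k, f k (y k)),
    integral_fintype_prod_volume_eq_prod]
  simp only [f]
  simp_rw [integral_affine_mul_affine_mul_exp_mul_exp hs ht]
  simp only [Finset.prod_mul_distrib, ← Real.exp_sum, EuclideanSpace.real_norm_sq_eq,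
      Finset.sum_neg_distrib, Finset.mul_sum, PiLp.sub_apply, Finset.prod_const]
  rw [Finset.card_univ, Fintype.card_fin, mul_assoc, mul_comm]
  congr 1
  have hst : s + t ≠ 0 := by positivity
  fin_cases i <;> fin_cases j <;> simp [Fin.prod_univ_three, p] <;> field_simp <;> ring_nf

/-- An inverse-square singularity with inverse fourth power decay is integrable in dimension
three. -/
lemma integrable_radial_inv {ρ : ℝ} (hρ : 0 < ρ) (a : EuclideanSpace ℝ (Fin 3)) :
    Integrable fun y : EuclideanSpace ℝ (Fin 3) => (‖y - a‖ ^ 2 * (‖y - a‖ + ρ) ^ 2)⁻¹ := by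
  have h : Integrable fun y : EuclideanSpace ℝ (Fin 3) => (‖y‖ ^ 2 * (‖y‖ + ρ) ^ 2)⁻¹ := by
    rw [integrable_fun_norm_addHaar volume (f := fun x : ℝ => (x ^ 2 * (x + ρ) ^ 2)⁻¹)]
    have := integrableOn_add_rpow_Ioi_of_lt (a := -2) (c := 0) (m := ρ) (by norm_num) (by simpa)
    refine this.congr_fun (fun x hx => ?_) measurableSet_Ioi
    have hx : 0 < x := hx
    simp only [finrank_euclideanSpace, Fintype.card_fin, smul_eq_mul]
    rw [Real.rpow_neg (by positivity), Real.rpow_two]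
    field_simp
  exact h.comp_sub_right a

lemma integrable_potential_gradient (a b : EuclideanSpace ℝ (Fin 3)) (hab : a ≠ b)
    (i j : Fin 3) :
    Integrable (fun y : EuclideanSpace ℝ (Fin 3) =>
      ((y - a) i * (y - b) j) / (‖y - a‖ ^ 3 * ‖y - b‖ ^ 3)) := by
  have hρ : 0 < ‖a - b‖ := norm_pos_iff.2 (sub_ne_zero.2 hab)
  have hmeas : Measurable fun y : EuclideanSpace ℝ (Fin 3) =>
      ((y - a) i * (y - b) j) / (‖y - a‖ ^ 3 * ‖y - b‖ ^ 3) := by fun_prop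
  refine (((integrable_radial_inv hρ a).const_mul 9).add
    ((integrable_radial_inv hρ b).const_mul 9)).mono' hmeas.aestronglyMeasurable
      (.of_forall fun y => ?_)
  have ha := PiLp.norm_apply_le (y - a) i
  have hb := PiLp.norm_apply_le (y - b) j
  have htri : ‖a - b‖ ≤ ‖y - a‖ + ‖y - b‖ := by
    rw [norm_sub_rev y a]; exact norm_sub_le_norm_sub_add_norm_sub a y b
  simp only [norm_div, norm_mul, norm_pow, norm_norm, Pi.add_apply]
  have hx := norm_nonneg (y - a)
  have hz := norm_nonneg (y - b)
  generalize ‖y - a‖ = x at *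
  generalize ‖y - b‖ = z at *
  rcases hx.eq_or_lt with rfl | hx
  · simp only [ne_eq, OfNat.ofNat_ne_zero, not_false_eq_true, zero_pow, zero_mul, div_zero]
    positivity
  rcases hz.eq_or_lt with rfl | hz
  · simp only [ne_eq, OfNat.ofNat_ne_zero, not_false_eq_true, zero_pow, mul_zero, div_zero]
    positivity
  generalize ‖a - b‖ = ρ at *
  have key : ‖(y - a) i‖ * ‖(y - b) j‖ / (x ^ 3 * z ^ 3) ≤ (x ^ 2 * z ^ 2)⁻¹ := by
    calc _ ≤ x * z / (x ^ 3 * z ^ 3) := by gcongr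
      _ = _ := by field_simp
  refine key.trans ?_
  have aux : ∀ x z : ℝ, 0 < x → 0 < z → x ≤ z → ρ ≤ x + z →
      (x ^ 2 * z ^ 2)⁻¹ ≤ 9 * (x ^ 2 * (x + ρ) ^ 2)⁻¹ := by
    intro x z hx hz hxz h
    have h3 : (x + ρ) ^ 2 ≤ (3 * z) ^ 2 := by gcongr; linarith
    rw [← div_eq_mul_inv, le_div_iff₀ (by positivity), inv_mul_le_iff₀ (by positivity)]
    calc x ^ 2 * (x + ρ) ^ 2 ≤ x ^ 2 * (3 * z) ^ 2 := by gcongr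
      _ = _ := by ring
  rcases le_total x z with h | h
  · exact (aux x z hx hz h htri).trans (le_add_of_nonneg_right (by positivity))
  · rw [mul_comm (x ^ 2)]
    exact (aux z x hz hx h (by linarith)).trans (le_add_of_nonneg_left (by positivity))

/-- Moments of the inverse Gamma distribution. -/
lemma integral_rpow_mul_exp_neg_div {q k : ℝ} (hq : 0 < q) (hk : 0 < k) :
    ∫ u in Set.Ioi (0 : ℝ), u ^ (-q - 1) * Real.exp (-(k / u)) = (1 / k) ^ q * Real.Gamma q := by
  rw [← Real.integral_rpow_mul_exp_neg_mul_Ioi hq hk,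
    ← integral_comp_rpow_Ioi (fun u : ℝ => u ^ (q - 1) * Real.exp (-(k * u)))
      (show (-1 : ℝ) ≠ 0 by norm_num)]
  refine setIntegral_congr_fun measurableSet_Ioi fun u hu => ?_
  have hu : 0 < u := hu
  simp only [abs_neg, abs_one, one_mul, smul_eq_mul]
  rw [← Real.rpow_mul hu.le, ← mul_assoc, ← Real.rpow_add hu, Real.rpow_neg_one]
  congr 2
  ring

lemma integrableOn_rpow_mul_exp_neg_div {q k : ℝ} (hq : 0 < q) (hk : 0 < k) :
    IntegrableOn (fun u : ℝ => u ^ (-q - 1) * Real.exp (-(k / u))) (Set.Ioi 0) := by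
  refine Integrable.of_integral_ne_zero ?_
  rw [integral_rpow_mul_exp_neg_div hq hk]
  have := Real.Gamma_pos_of_pos hq
  positivity

/-- A function of the sum of two positive variables integrates over the quadrant like
`u ↦ u * H u` over the half-line. -/
lemma integral_integral_comp_add_Ioi {H : ℝ → ℝ} (hm : Measurable H)
    (hH : IntegrableOn (fun u => u * H u) (Set.Ioi 0)) :
    ∫ α in Set.Ioi (0 : ℝ), ∫ β in Set.Ioi (0 : ℝ), H (α + β) =
      ∫ u in Set.Ioi (0 : ℝ), u * H u := by
  have hind : ∀ u α : ℝ, (Set.Ioi α).indicator H u = (Set.Iio u).indicator (fun _ => H u) α :=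
    fun u α => by simp [Set.indicator_apply]
  have hvol : ∀ u : ℝ, 0 < u →
      (volume.restrict (Set.Ioi (0 : ℝ))).real (Set.Iio u) = u := fun u hu => by
    rw [measureReal_restrict_apply measurableSet_Iio, Set.inter_comm, Set.Ioi_inter_Iio]
    simp [hu.le]
  have h1 : ∀ α ∈ Set.Ioi (0 : ℝ), ∫ β in Set.Ioi (0 : ℝ), H (α + β) =
      ∫ u in Set.Ioi (0 : ℝ), (Set.Ioi α).indicator H u := by
    intro α hα
    have hα : 0 < α := hα
    rw [setIntegral_indicator measurableSet_Ioi, Set.Ioi_inter_Ioi, sup_of_le_right hα.le]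
    have := (measurePreserving_add_left volume α).setIntegral_preimage_emb
      (measurableEmbedding_addLeft α) H (Set.Ioi α)
    simpa using this
  rw [setIntegral_congr_fun measurableSet_Ioi h1, integral_integral_swap]
  · refine setIntegral_congr_fun measurableSet_Ioi fun u hu => ?_
    simp only [hind]
    rw [integral_indicator_const _ measurableSet_Iio, hvol u hu, smul_eq_mul]
  · have hmeas : Measurable (Function.uncurry fun α u : ℝ => (Set.Ioi α).indicator H u) := by
      have : (Function.uncurry fun α u : ℝ => (Set.Ioi α).indicator H u) =
          {p : ℝ × ℝ | p.1 < p.2}.indicator (fun p => H p.2) := by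
        ext ⟨α, u⟩; simp [Set.indicator_apply]
      rw [this]
      exact (hm.comp measurable_snd).indicator (measurableSet_lt measurable_fst measurable_snd)
    rw [integrable_prod_iff' hmeas.aestronglyMeasurable]
    simp only [Function.uncurry, hind]
    constructor
    · filter_upwards with u
      rw [integrable_indicator_iff measurableSet_Iio]
      refine integrableOn_const ?_
      rw [Measure.restrict_apply measurableSet_Iio, Set.inter_comm, Set.Ioi_inter_Iio]
      simp
    · refine hH.norm.congr ?_
      filter_upwards [ae_restrict_mem measurableSet_Ioi] with u hu
      have hu' : 0 < u := hu
      simp only [norm_indicator_eq_indicator_norm]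
      rw [integral_indicator_const _ measurableSet_Iio, hvol u hu, smul_eq_mul, norm_mul,
        Real.norm_of_nonneg hu'.le]

lemma rpow_neg_three_halves_sub_one {u : ℝ} (hu : 0 < u) :
    u ^ (-(3 / 2) - 1 : ℝ) = (√u ^ 5)⁻¹ := by
  rw [Real.sqrt_eq_rpow, ← Real.rpow_natCast, ← Real.rpow_mul hu.le, ← Real.rpow_neg hu.le]
  norm_num

lemma Gamma_three_halves : Real.Gamma (3 / 2) = √Real.pi / 2 := by
  rw [show (3 : ℝ) / 2 = 1 / 2 + 1 by norm_num, Real.Gamma_add_one (by norm_num),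
    Real.Gamma_one_half_eq]
  ring

/-- The inverse cube of a positive number as a superposition of Gaussians. -/
lemma integral_rpow_mul_exp_neg_sq_div {x : ℝ} (hx : 0 < x) :
    ∫ u in Set.Ioi (0 : ℝ), u ^ (-(3 / 2) - 1 : ℝ) * Real.exp (-(x ^ 2 / u)) =
      √Real.pi / 2 / x ^ 3 := by
  rw [integral_rpow_mul_exp_neg_div (by norm_num) (by positivity), Gamma_three_halves, one_div,
    Real.inv_rpow (by positivity), ← Real.rpow_natCast x 2, ← Real.rpow_mul hx.le]
  norm_num
  ring_nf

/-- The three-dimensional Gaussian integral for widths `α`, `β` depends on them only through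
`α + β` once the weights of the superposition are included. -/
lemma integral_weighted_gaussian {α β : ℝ} (hα : 0 < α) (hβ : 0 < β)
    (a b : EuclideanSpace ℝ (Fin 3)) (i j : Fin 3) :
    ∫ y : EuclideanSpace ℝ (Fin 3), (y - a) i * (y - b) j *
        ((α ^ (-(3 / 2) - 1 : ℝ) * Real.exp (-(‖y - a‖ ^ 2 / α))) *
          (β ^ (-(3 / 2) - 1 : ℝ) * Real.exp (-(‖y - b‖ ^ 2 / β)))) =
      √Real.pi ^ 3 * ((α + β) ^ (-(3 / 2) - 1 : ℝ) * Real.exp (-(‖a - b‖ ^ 2 / (α + β)))) *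
        ((if i = j then (1 : ℝ) else 0) / 2 - (a - b) i * (a - b) j / (α + β)) := by
  have h := integral_coord_mul_coord_mul_gaussian (inv_pos.2 hα) (inv_pos.2 hβ) a b i j
  have e : ∀ y : EuclideanSpace ℝ (Fin 3), (y - a) i * (y - b) j *
        ((α ^ (-(3 / 2) - 1 : ℝ) * Real.exp (-(‖y - a‖ ^ 2 / α))) *
          (β ^ (-(3 / 2) - 1 : ℝ) * Real.exp (-(‖y - b‖ ^ 2 / β)))) =
      (α ^ (-(3 / 2) - 1 : ℝ) * β ^ (-(3 / 2) - 1 : ℝ)) * ((y - a) i * (y - b) j *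
        (Real.exp (-(α⁻¹ * ‖y - a‖ ^ 2)) * Real.exp (-(β⁻¹ * ‖y - b‖ ^ 2)))) := fun y => by
    rw [div_eq_inv_mul, div_eq_inv_mul]
    ring
  simp_rw [e]
  have hαβ : 0 < α + β := by positivity
  have e1 : α⁻¹ * β⁻¹ / (α⁻¹ + β⁻¹) * ‖a - b‖ ^ 2 = ‖a - b‖ ^ 2 / (α + β) := by
    field_simp
    ring
  have e2 : √(Real.pi / (α⁻¹ + β⁻¹)) = √Real.pi * (√α * √β / √(α + β)) := by
    rw [← Real.sqrt_mul hα.le, ← Real.sqrt_div (by positivity), ← Real.sqrt_mul Real.pi_pos.le]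
    congr 1
    field_simp
    ring
  rw [integral_const_mul, h, e1, e2, rpow_neg_three_halves_sub_one hα,
    rpow_neg_three_halves_sub_one hβ, rpow_neg_three_halves_sub_one hαβ]
  have hp := Real.sqrt_pos.2 hα
  have hq := Real.sqrt_pos.2 hβ
  have hw := Real.sqrt_pos.2 hαβ
  have e3 : (if i = j then (1 : ℝ) else 0) / (2 * (α⁻¹ + β⁻¹)) -
      α⁻¹ * β⁻¹ * ((a - b) i * (a - b) j) / (α⁻¹ + β⁻¹) ^ 2 =
      √α ^ 2 * √β ^ 2 / √(α + β) ^ 2 *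
        ((if i = j then (1 : ℝ) else 0) / 2 - (a - b) i * (a - b) j / (α + β)) := by
    rw [Real.sq_sqrt hα.le, Real.sq_sqrt hβ.le, Real.sq_sqrt hαβ.le,
      show α⁻¹ + β⁻¹ = (α + β) / (α * β) by field_simp; ring]
    field_simp
  rw [e3]
  field_simp

/-- The potential-potential integral of the gravitational-wave derivation:
`∫ ∂_i(1/‖y − a‖) · ∂_j(1/‖y − b‖) dy = (2π/‖a−b‖)(δ_{ij} − n̂_i n̂_j)` with `n̂` the
unit vector along `a − b`; explicitly, the integrand
`((y − a)_i (y − b)_j)/(‖y − a‖³ ‖y − b‖³)` is integrable with integral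
`(2π/‖a − b‖)(δ_{ij} − (a − b)_i (a − b)_j/‖a − b‖²)`. -/
theorem potential_gradient_integral (a b : EuclideanSpace ℝ (Fin 3)) (hab : a ≠ b)
    (i j : Fin 3) :
    Integrable (fun y : EuclideanSpace ℝ (Fin 3) =>
      ((y - a) i * (y - b) j) / (‖y - a‖ ^ 3 * ‖y - b‖ ^ 3)) ∧
    ∫ y : EuclideanSpace ℝ (Fin 3),
        ((y - a) i * (y - b) j) / (‖y - a‖ ^ 3 * ‖y - b‖ ^ 3) =
      (2 * Real.pi / ‖a - b‖) *
        ((if i = j then (1 : ℝ) else 0) - ((a - b) i * (a - b) j) / ‖a - b‖ ^ 2) := by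
  have hint := integrable_potential_gradient a b hab i j
  refine ⟨hint, ?_⟩
  have hρ : 0 < ‖a - b‖ := norm_pos_iff.2 (sub_ne_zero.2 hab)
  let ν : Measure ℝ := volume.restrict (Set.Ioi 0)
  let g : ℝ → ℝ → ℝ := fun x u => u ^ (-(3 / 2) - 1 : ℝ) * Real.exp (-(x ^ 2 / u))
  let F : EuclideanSpace ℝ (Fin 3) → ℝ × ℝ → ℝ := fun y z =>
    (y - a) i * (y - b) j * (g ‖y - a‖ z.1 * g ‖y - b‖ z.2)
  have hae : ∀ᵐ y : EuclideanSpace ℝ (Fin 3), 0 < ‖y - a‖ ∧ 0 < ‖y - b‖ := by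
    filter_upwards [Measure.ae_ne volume a, Measure.ae_ne volume b] with y ha hb
    exact ⟨norm_pos_iff.2 (sub_ne_zero.2 ha), norm_pos_iff.2 (sub_ne_zero.2 hb)⟩
  have hgi : ∀ x : ℝ, 0 < x → Integrable (g x) ν := fun x hx =>
    integrableOn_rpow_mul_exp_neg_div (by norm_num) (by positivity)
  have hg : ∀ x : ℝ, 0 < x → ∫ u, g x u ∂ν = √Real.pi / 2 / x ^ 3 := fun x hx =>
    integral_rpow_mul_exp_neg_sq_div hx
  have hgn : ∀ x : ℝ, 0 < x → ∫ u, ‖g x u‖ ∂ν = √Real.pi / 2 / x ^ 3 := fun x hx => by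
    rw [← hg x hx]
    refine setIntegral_congr_fun measurableSet_Ioi fun u hu => ?_
    have hu : 0 < u := hu
    exact Real.norm_of_nonneg (by positivity)
  have hF : Integrable (Function.uncurry F) (volume.prod (ν.prod ν)) := by
    have hmeas : Measurable (Function.uncurry F) := by
      simp only [Function.uncurry_def, F, g]
      fun_prop
    rw [integrable_prod_iff hmeas.aestronglyMeasurable]
    constructor
    · filter_upwards [hae] with y hy
      exact ((hgi _ hy.1).mul_prod (hgi _ hy.2)).const_mul ((y - a) i * (y - b) j)
    · refine (hint.norm.const_mul (Real.pi / 4)).congr ?_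
      filter_upwards [hae] with y hy
      simp only [Function.uncurry, F, norm_mul]
      rw [integral_const_mul, integral_prod_mul (fun u => ‖g ‖y - a‖ u‖) (fun u => ‖g ‖y - b‖ u‖),
        hgn _ hy.1, hgn _ hy.2]
      simp only [norm_div, norm_mul, norm_pow, norm_norm]
      have h1 := hy.1
      have h2 := hy.2
      field_simp
      rw [Real.sq_sqrt Real.pi_pos.le]
      ring
  have hleft : ∫ y, ∫ z, F y z ∂(ν.prod ν) = Real.pi / 4 *
      ∫ y : EuclideanSpace ℝ (Fin 3),
        ((y - a) i * (y - b) j) / (‖y - a‖ ^ 3 * ‖y - b‖ ^ 3) := by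
    rw [← integral_const_mul]
    refine integral_congr_ae ?_
    filter_upwards [hae] with y hy
    simp only [F]
    rw [integral_const_mul, integral_prod_mul (g ‖y - a‖) (g ‖y - b‖), hg _ hy.1, hg _ hy.2]
    have h1 := hy.1
    have h2 := hy.2
    field_simp
    rw [Real.sq_sqrt Real.pi_pos.le]
    ring
  let H : ℝ → ℝ := fun u => √Real.pi ^ 3 * g ‖a - b‖ u *
    ((if i = j then (1 : ℝ) else 0) / 2 - (a - b) i * (a - b) j / u)
  have hHm : Measurable H := by
    simp only [H, g]
    fun_prop
  let k : ℝ → ℝ := fun u => u ^ (-(1 / 2) - 1 : ℝ) * Real.exp (-(‖a - b‖ ^ 2 / u))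
  have hki : Integrable k ν :=
    integrableOn_rpow_mul_exp_neg_div (by norm_num) (by positivity)
  have hk : ∫ u, k u ∂ν = √Real.pi / ‖a - b‖ := by
    refine (integral_rpow_mul_exp_neg_div (by norm_num) (by positivity)).trans ?_
    rw [← Real.sqrt_eq_rpow, Real.Gamma_one_half_eq, Real.sqrt_div zero_le_one,
      Real.sqrt_sq hρ.le, Real.sqrt_one]
    ring
  have hHeq : ∀ u ∈ Set.Ioi (0 : ℝ), u * H u = √Real.pi ^ 3 *
      ((if i = j then (1 : ℝ) else 0) / 2 * k u - (a - b) i * (a - b) j * g ‖a - b‖ u) := by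
    intro u hu
    have hu : 0 < u := hu
    have : u ^ (-(1 / 2) - 1 : ℝ) = u * u ^ (-(3 / 2) - 1 : ℝ) := by
      rw [← Real.rpow_one_add' hu.le (by norm_num)]
      norm_num
    simp only [H, g, k, this]
    field_simp
  have hHi : IntegrableOn (fun u => u * H u) (Set.Ioi 0) := by
    rw [integrableOn_congr_fun hHeq measurableSet_Ioi]
    exact ((hki.const_mul _).sub ((hgi _ hρ).const_mul _)).const_mul _
  have hright : ∫ z, (∫ y, F y z) ∂(ν.prod ν) = ∫ u in Set.Ioi (0 : ℝ), u * H u := by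
    have hFz : Integrable (fun z => ∫ y, F y z) (ν.prod ν) := hF.integral_prod_right
    rw [integral_prod _ hFz, ← integral_integral_comp_add_Ioi hHm hHi]
    refine setIntegral_congr_fun measurableSet_Ioi fun α hα => ?_
    refine setIntegral_congr_fun measurableSet_Ioi fun β hβ => ?_
    exact integral_weighted_gaussian hα hβ a b i j
  have hval : ∫ u in Set.Ioi (0 : ℝ), u * H u = √Real.pi ^ 3 *
      ((if i = j then (1 : ℝ) else 0) / 2 * (√Real.pi / ‖a - b‖) -
        (a - b) i * (a - b) j * (√Real.pi / 2 / ‖a - b‖ ^ 3)) := by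
    rw [setIntegral_congr_fun measurableSet_Ioi hHeq, integral_const_mul,
      integral_sub (hki.const_mul _) ((hgi _ hρ).const_mul _), integral_const_mul,
      integral_const_mul, hk, hg _ hρ]
  rw [integral_integral_swap hF, hright, hval] at hleft
  have h4 : √Real.pi ^ 4 = Real.pi ^ 2 := by
    rw [show 4 = 2 * 2 by norm_num, pow_mul, Real.sq_sqrt Real.pi_pos.le]
  refine mul_left_cancel₀ (show Real.pi / 4 ≠ 0 by positivity) (hleft.symm.trans ?_)
  linear_combination ((if i = j then (1 : ℝ) else 0) / (2 * ‖a - b‖) -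
    (a - b) i * (a - b) j / (2 * ‖a - b‖ ^ 3)) * h4
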